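/- Let n ≥ 1 and let K ⊆ ℝ^n be a nonempty open set. Then there exists a smooth map τ : ℝ^n × ℝ^n → ℝ^n and a compact set C ⊆ K such that: (i) τ is an ℝ^n-action, i.e. τ_0 = id and τ_x ∘ τ_{x'} = τ_{x+x'} for all x, x' ∈ ℝ^n (writing τ_x(y) := τ(x,y)); (ii) τ has support in C, i.e. τ_x(y) = y for all x ∈ ℝ^n and all y ∉ C; (iii) τ is nontrivial: there exist x, y with τ_x(y) ≠ y; and (iv) τ is polynomially bounded: for all multiindices μ, ν ∈ ℕ^n there exist constants c > 0 and b ≥ 0, with b = 0 whenever ν = 0, such that sup_{y∈C, 1≤j≤n} |∂_y^ν ∂_x^μ τ_x(y)_j| ≤ c (1+‖x‖²)^{b/2} for all x ∈ ℝ^n. -/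

import Mathlib

open Filter MeasureTheory

noncomputable def pder {n : ℕ} {V : Type*} [NormedAddCommGroup V] [NormedSpace ℝ V]
    (i : Fin n) (f : (Fin n → ℝ) → V) : (Fin n → ℝ) → V :=
  fun x => fderiv ℝ f x (Pi.single i 1)

noncomputable def mder {n : ℕ} {V : Type*} [NormedAddCommGroup V] [NormedSpace ℝ V]
    (μ : Fin n → ℕ) (f : (Fin n → ℝ) → V) : (Fin n → ℝ) → V :=
  (List.finRange n).foldr (fun i g => (pder i)^[μ i] g) f

def mOrder {n : ℕ} (μ : Fin n → ℕ) : ℕ := ∑ i, μ i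

noncomputable def symWt {n : ℕ} (m ρ : ℝ) (μ : Fin n → ℕ) (x : Fin n → ℝ) : ℝ :=
  (1 + ‖x‖ ^ 2) ^ (-(m - ρ * (mOrder μ : ℝ)) / 2)

noncomputable def symNorm {n : ℕ} {V : Type*} [NormedAddCommGroup V] [NormedSpace ℝ V]
    (m ρ : ℝ) (μ : Fin n → ℕ) (F : (Fin n → ℝ) → V) : ℝ :=
  ⨆ x : Fin n → ℝ, symWt m ρ μ x * ‖mder μ F x‖

def IsSymbol {n : ℕ} {V : Type*} [NormedAddCommGroup V] [NormedSpace ℝ V]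
    (m ρ : ℝ) (F : (Fin n → ℝ) → V) : Prop :=
  ContDiff ℝ (⊤ : ℕ∞) F ∧ ∀ μ : Fin n → ℕ, ∃ C : ℝ, ∀ x, symWt m ρ μ x * ‖mder μ F x‖ ≤ C

/-- `f` is bounded on `D` by a constant multiple of a power of `1 + s`. -/
def PolyBdd {α : Type*} (s : α → ℝ) (D : Set α) (f : α → ℝ) : Prop :=
  ∃ c : ℝ, ∃ b : ℕ, 0 ≤ c ∧ ∀ a ∈ D, |f a| ≤ c * (1 + s a) ^ b

namespace PolyBdd

variable {α : Type*} {s : α → ℝ} {D : Set α} {f g : α → ℝ}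

theorem add (hs : ∀ a, 0 ≤ s a) (hf : PolyBdd s D f) (hg : PolyBdd s D g) :
    PolyBdd s D (fun a => f a + g a) := by
  obtain ⟨c, b, hc, hf⟩ := hf
  obtain ⟨c', b', hc', hg⟩ := hg
  refine ⟨c + c', b + b', by positivity, fun a ha => ?_⟩
  have h1 : 1 ≤ 1 + s a := by linarith [hs a]
  have e1 : (1 + s a) ^ b ≤ (1 + s a) ^ (b + b') := pow_le_pow_right₀ h1 (by omega)
  have e2 : (1 + s a) ^ b' ≤ (1 + s a) ^ (b + b') := pow_le_pow_right₀ h1 (by omega)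
  calc |f a + g a| ≤ |f a| + |g a| := abs_add_le _ _
    _ ≤ c * (1 + s a) ^ b + c' * (1 + s a) ^ b' := add_le_add (hf a ha) (hg a ha)
    _ ≤ c * (1 + s a) ^ (b + b') + c' * (1 + s a) ^ (b + b') := by gcongr
    _ = _ := by ring

theorem mul (hs : ∀ a, 0 ≤ s a) (hf : PolyBdd s D f) (hg : PolyBdd s D g) :
    PolyBdd s D (fun a => f a * g a) := by
  obtain ⟨c, b, hc, hf⟩ := hf
  obtain ⟨c', b', hc', hg⟩ := hg
  refine ⟨c * c', b + b', by positivity, fun a ha => ?_⟩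
  have h1 : 0 ≤ 1 + s a := by linarith [hs a]
  calc |f a * g a| = |f a| * |g a| := abs_mul _ _
    _ ≤ (c * (1 + s a) ^ b) * (c' * (1 + s a) ^ b') :=
      mul_le_mul (hf a ha) (hg a ha) (abs_nonneg _) (by positivity)
    _ = _ := by ring

theorem of_bounded {c : ℝ} (h : ∀ a ∈ D, |f a| ≤ c) : PolyBdd s D f :=
  ⟨|c|, 0, abs_nonneg c, fun a ha => by simpa using (h a ha).trans (le_abs_self c)⟩

end PolyBdd

/-- The partial derivative in the time variable. -/
noncomputable def dT (f : ℝ × ℝ → ℝ) (p : ℝ × ℝ) : ℝ := fderiv ℝ f p (1, 0)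

/-- The partial derivative in the space variable. -/
noncomputable def dY (f : ℝ × ℝ → ℝ) (p : ℝ × ℝ) : ℝ := fderiv ℝ f p (0, 1)

section Partial

variable {f g : ℝ × ℝ → ℝ}

theorem contDiff_dT (hf : ContDiff ℝ (⊤ : ℕ∞) f) : ContDiff ℝ (⊤ : ℕ∞) (dT f) :=
  (hf.fderiv_right (m := (⊤ : ℕ∞)) (by simp)).clm_apply contDiff_const

theorem contDiff_dY (hf : ContDiff ℝ (⊤ : ℕ∞) f) : ContDiff ℝ (⊤ : ℕ∞) (dY f) :=
  (hf.fderiv_right (m := (⊤ : ℕ∞)) (by simp)).clm_apply contDiff_const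

theorem contDiff_iterate_dY (hf : ContDiff ℝ (⊤ : ℕ∞) f) (i : ℕ) :
    ContDiff ℝ (⊤ : ℕ∞) (dY^[i] f) := by
  induction i with
  | zero => exact hf
  | succ i ih => rw [Function.iterate_succ_apply']; exact contDiff_dY ih

theorem ContDiff.differentiableAt_top {E F : Type*} [NormedAddCommGroup E] [NormedSpace ℝ E]
    [NormedAddCommGroup F] [NormedSpace ℝ F] {f : E → F}
    (hf : ContDiff ℝ (⊤ : ℕ∞) f) (p : E) : DifferentiableAt ℝ f p :=
  hf.differentiable (by simp) p

theorem dT_dY (hf : ContDiff ℝ (⊤ : ℕ∞) f) : dT (dY f) = dY (dT f) := by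
  funext p
  have h2 : DifferentiableAt ℝ (fderiv ℝ f) p :=
    (hf.fderiv_right (m := (⊤ : ℕ∞)) (by simp)).differentiableAt_top p
  have hsym : IsSymmSndFDerivAt ℝ f p :=
    (hf.contDiffAt (x := p)).isSymmSndFDerivAt (by simp; exact WithTop.coe_le_coe.2 le_top)
  have e : ∀ u w : ℝ × ℝ, fderiv ℝ (fun q => fderiv ℝ f q u) p w
      = fderiv ℝ (fderiv ℝ f) p w u := by
    intro u w
    rw [fderiv_clm_apply h2 (differentiableAt_const _)]
    simp
  change fderiv ℝ (fun q => fderiv ℝ f q (0, 1)) p (1, 0)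
    = fderiv ℝ (fun q => fderiv ℝ f q (1, 0)) p (0, 1)
  rw [e, e]
  exact hsym _ _

theorem dT_iterate_dY (hf : ContDiff ℝ (⊤ : ℕ∞) f) (i : ℕ) :
    dT (dY^[i] f) = dY^[i] (dT f) := by
  induction i with
  | zero => rfl
  | succ i ih =>
    rw [Function.iterate_succ_apply', Function.iterate_succ_apply',
      dT_dY (contDiff_iterate_dY hf i), ih]

theorem dY_add (hf : ContDiff ℝ (⊤ : ℕ∞) f) (hg : ContDiff ℝ (⊤ : ℕ∞) g) :
    dY (fun p => f p + g p) = fun p => dY f p + dY g p := by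
  funext p
  simp only [dY]
  rw [fderiv_fun_add (hf.differentiableAt_top p) (hg.differentiableAt_top p)]
  simp

theorem dY_mul (hf : ContDiff ℝ (⊤ : ℕ∞) f) (hg : ContDiff ℝ (⊤ : ℕ∞) g) :
    dY (fun p => f p * g p) = fun p => dY f p * g p + f p * dY g p := by
  funext p
  simp only [dY]
  rw [fderiv_fun_mul (hf.differentiableAt_top p) (hg.differentiableAt_top p)]
  simp
  ring

theorem hasDerivAt_fst (hf : ContDiff ℝ (⊤ : ℕ∞) f) (t y : ℝ) :
    HasDerivAt (fun t => f (t, y)) (dT f (t, y)) t :=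
  (hf.differentiableAt_top (t, y)).hasFDerivAt.comp_hasDerivAt t
    ((hasDerivAt_id t).prodMk (hasDerivAt_const t y))

theorem hasDerivAt_snd (hf : ContDiff ℝ (⊤ : ℕ∞) f) (t y : ℝ) :
    HasDerivAt (fun y => f (t, y)) (dY f (t, y)) y :=
  (hf.differentiableAt_top (t, y)).hasFDerivAt.comp_hasDerivAt y
    ((hasDerivAt_const y t).prodMk (hasDerivAt_id y))

theorem dT_comp {w : ℝ → ℝ} (hw : ContDiff ℝ (⊤ : ℕ∞) w) (hf : ContDiff ℝ (⊤ : ℕ∞) f) :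
    dT (fun p => w (f p)) = fun p => deriv w (f p) * dT f p := by
  funext ⟨t, y⟩
  exact (hasDerivAt_fst (hw.comp hf) t y).unique
    ((hw.differentiableAt_top _).hasDerivAt.comp t (hasDerivAt_fst hf t y))

theorem dY_comp {w : ℝ → ℝ} (hw : ContDiff ℝ (⊤ : ℕ∞) w) (hf : ContDiff ℝ (⊤ : ℕ∞) f) :
    dY (fun p => w (f p)) = fun p => deriv w (f p) * dY f p := by
  funext ⟨t, y⟩
  exact (hasDerivAt_snd (hw.comp hf) t y).unique
    ((hw.differentiableAt_top _).hasDerivAt.comp y (hasDerivAt_snd hf t y))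

theorem dY_eq_zero_of_const (hf : ContDiff ℝ (⊤ : ℕ∞) f) {t c : ℝ} (h : ∀ y, f (t, y) = c)
    (y : ℝ) : dY f (t, y) = 0 := by
  have := hasDerivAt_snd hf t y
  simp only [h] at this
  exact this.unique (hasDerivAt_const y c)

theorem ContDiff.deriv_top {w : ℝ → ℝ} (hw : ContDiff ℝ (⊤ : ℕ∞) w) :
    ContDiff ℝ (⊤ : ℕ∞) (deriv w) :=
  (contDiff_infty_iff_deriv.1 hw).2

end Partial

/-- Polynomial boundedness in time, uniformly in space over `[-1, 1]`. -/
def PolyBddTime (f : ℝ × ℝ → ℝ) : Prop :=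
  PolyBdd (fun p : ℝ × ℝ => |p.1|) {p | |p.2| ≤ 1} f

/-- `f` is smooth and its space derivatives up to order `m` are polynomially bounded in time. -/
def PolyBddUpTo : ℕ → (ℝ × ℝ → ℝ) → Prop
  | 0, f => ContDiff ℝ (⊤ : ℕ∞) f ∧ PolyBddTime f
  | m + 1, f => ContDiff ℝ (⊤ : ℕ∞) f ∧ PolyBddTime f ∧ PolyBddUpTo m (dY f)

namespace PolyBddUpTo

variable {f g : ℝ × ℝ → ℝ}

theorem contDiff {m : ℕ} (h : PolyBddUpTo m f) : ContDiff ℝ (⊤ : ℕ∞) f := by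
  cases m <;> exact h.1

theorem polyBddTime {m : ℕ} (h : PolyBddUpTo m f) : PolyBddTime f := by
  cases m
  · exact h.2
  · exact h.2.1

theorem of_succ {m : ℕ} (h : PolyBddUpTo (m + 1) f) : PolyBddUpTo m f := by
  induction m generalizing f with
  | zero => exact ⟨h.1, h.2.1⟩
  | succ m ih => exact ⟨h.1, h.2.1, ih h.2.2⟩

theorem add {m : ℕ} (hf : PolyBddUpTo m f) (hg : PolyBddUpTo m g) :
    PolyBddUpTo m (fun p => f p + g p) := by
  induction m generalizing f g with
  | zero => exact ⟨hf.1.add hg.1, PolyBdd.add (fun _ => abs_nonneg _) hf.2 hg.2⟩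
  | succ m ih =>
    refine ⟨hf.1.add hg.1, PolyBdd.add (fun _ => abs_nonneg _) hf.2.1 hg.2.1, ?_⟩
    rw [dY_add hf.1 hg.1]
    exact ih hf.2.2 hg.2.2

theorem mul {m : ℕ} (hf : PolyBddUpTo m f) (hg : PolyBddUpTo m g) :
    PolyBddUpTo m (fun p => f p * g p) := by
  induction m generalizing f g with
  | zero => exact ⟨hf.1.mul hg.1, PolyBdd.mul (fun _ => abs_nonneg _) hf.2 hg.2⟩
  | succ m ih =>
    refine ⟨hf.1.mul hg.1, PolyBdd.mul (fun _ => abs_nonneg _) hf.2.1 hg.2.1, ?_⟩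
    rw [dY_mul hf.1 hg.1]
    exact add (ih hf.2.2 hg.of_succ) (ih hf.of_succ hg.2.2)

theorem iterate {m : ℕ} (hf : PolyBddUpTo m f) : PolyBddTime (dY^[m] f) := by
  induction m generalizing f with
  | zero => exact hf.2
  | succ m ih => exact ih hf.2.2

end PolyBddUpTo

theorem PolyBddTime.of_dT {f : ℝ × ℝ → ℝ} (hf : ContDiff ℝ (⊤ : ℕ∞) f) (h0 : ∀ y, f (0, y) = 0)
    (h : PolyBddTime (dT f)) : PolyBddTime f := by
  obtain ⟨c, b, hc, h⟩ := h
  refine ⟨c, b + 1, hc, ?_⟩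
  rintro ⟨t, y⟩ hy
  have key := (convex_closedBall (0 : ℝ) |t|).norm_image_sub_le_of_norm_hasDerivWithin_le
    (f := fun t => f (t, y)) (f' := fun t => dT f (t, y)) (C := c * (1 + |t|) ^ b)
    (x := 0) (y := t) (fun u _ => (hasDerivAt_fst hf u y).hasDerivWithinAt)
    (fun u hu => by
      have hu' : |u| ≤ |t| := by simpa using hu
      refine (h (u, y) hy).trans ?_
      dsimp only
      gcongr)
    (by simp) (by simp)
  simp only [h0, sub_zero, Real.norm_eq_abs] at key
  calc |f (t, y)| ≤ c * (1 + |t|) ^ b * |t| := key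
    _ ≤ c * (1 + |t|) ^ b * (1 + |t|) := by gcongr; linarith
    _ = _ := by ring

theorem PolyBddUpTo.of_dT {m : ℕ} {f : ℝ × ℝ → ℝ} (hf : ContDiff ℝ (⊤ : ℕ∞) f)
    (h0 : ∀ y, f (0, y) = 0) (h : PolyBddUpTo m (dT f)) : PolyBddUpTo m f := by
  induction m generalizing f with
  | zero => exact ⟨hf, .of_dT hf h0 h.2⟩
  | succ m ih =>
    refine ⟨hf, .of_dT hf h0 h.2.1, ih (contDiff_dY hf) (dY_eq_zero_of_const hf h0) ?_⟩
    rw [dT_dY hf]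
    exact h.2.2

/-- A smooth flow on the line that preserves `[-1, 1]` and whose space derivative is polynomially
bounded in time. -/
structure TameFlow (Φ : ℝ × ℝ → ℝ) : Prop where
  contDiff : ContDiff ℝ (⊤ : ℕ∞) Φ
  zero : ∀ y, Φ (0, y) = y
  comp : ∀ s t y, Φ (s, Φ (t, y)) = Φ (s + t, y)
  maps : ∀ t y, |y| ≤ 1 → |Φ (t, y)| ≤ 1
  bdd : PolyBddTime (dY Φ)

namespace TameFlow

variable {Φ : ℝ × ℝ → ℝ}

/-- The vector field generating a flow. -/
noncomputable def field (Φ : ℝ × ℝ → ℝ) (y : ℝ) : ℝ := dT Φ (0, y)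

theorem contDiff_field (h : TameFlow Φ) : ContDiff ℝ (⊤ : ℕ∞) (field Φ) :=
  (contDiff_dT h.contDiff).comp (contDiff_const.prodMk contDiff_id)

theorem dT_eq (h : TameFlow Φ) : dT Φ = fun p => field Φ (Φ p) := by
  funext ⟨t, y⟩
  have h1 : HasDerivAt (fun s => Φ (s, Φ (t, y))) (field Φ (Φ (t, y))) 0 :=
    hasDerivAt_fst h.contDiff 0 _
  have h2 : HasDerivAt (fun s => Φ (s + t, y)) (dT Φ (t, y)) 0 := by
    have := hasDerivAt_fst h.contDiff (0 + t) y
    simpa using this.comp_add_const 0 t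
  simp only [h.comp] at h1
  exact h2.unique h1

theorem dT_comp_eq (h : TameFlow Φ) {w : ℝ → ℝ} (hw : ContDiff ℝ (⊤ : ℕ∞) w) :
    dT (fun p => w (Φ p)) = fun p => (fun y => deriv w y * field Φ y) (Φ p) := by
  rw [dT_comp hw h.contDiff, h.dT_eq]

theorem dY_ne_zero (h : TameFlow Φ) (p : ℝ × ℝ) : dY Φ p ≠ 0 := by
  obtain ⟨t, y⟩ := p
  intro h0
  have h1 : HasDerivAt (fun y => Φ (-t, Φ (t, y))) (dY Φ (-t, Φ (t, y)) * dY Φ (t, y)) y :=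
    (hasDerivAt_snd h.contDiff (-t) _).comp y (hasDerivAt_snd h.contDiff t y)
  simp only [h.comp, neg_add_cancel, h.zero, h0, mul_zero] at h1
  exact zero_ne_one (h1.unique (hasDerivAt_id y))

theorem dY_zero (h : TameFlow Φ) (y : ℝ) : dY Φ (0, y) = 1 := by
  have h1 := hasDerivAt_snd h.contDiff 0 y
  simp only [h.zero] at h1
  exact h1.unique (hasDerivAt_id y)

theorem dT_dY_eq (h : TameFlow Φ) : dT (dY Φ) = fun p => deriv (field Φ) (Φ p) * dY Φ p := by
  rw [dT_dY h.contDiff, h.dT_eq, dY_comp h.contDiff_field h.contDiff]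

/-- The logarithmic space derivative of the Jacobian of a flow. -/
noncomputable def logJac (Φ : ℝ × ℝ → ℝ) (p : ℝ × ℝ) : ℝ := dY (dY Φ) p / dY Φ p

theorem contDiff_logJac (h : TameFlow Φ) : ContDiff ℝ (⊤ : ℕ∞) (logJac Φ) :=
  (contDiff_dY (contDiff_dY h.contDiff)).div (contDiff_dY h.contDiff) h.dY_ne_zero

theorem dT_logJac (h : TameFlow Φ) :
    dT (logJac Φ) = fun p => deriv (deriv (field Φ)) (Φ p) * dY Φ p := by
  have hJ := contDiff_dY h.contDiff
  have hv' := h.contDiff_field.deriv_top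
  have e : dT (dY (dY Φ)) = fun p => deriv (deriv (field Φ)) (Φ p) * dY Φ p * dY Φ p
      + deriv (field Φ) (Φ p) * dY (dY Φ) p := by
    have hv'Φ : ContDiff ℝ (⊤ : ℕ∞) fun p => deriv (field Φ) (Φ p) := hv'.comp h.contDiff
    rw [dT_dY hJ, h.dT_dY_eq, dY_mul hv'Φ hJ, dY_comp hv' h.contDiff]
  funext ⟨t, y⟩
  have h1 := (hasDerivAt_fst (contDiff_dY hJ) t y).fun_div (hasDerivAt_fst hJ t y)
    (h.dY_ne_zero (t, y))
  refine (hasDerivAt_fst h.contDiff_logJac t y).unique (h1.congr_deriv ?_)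
  rw [e, h.dT_dY_eq]
  have := h.dY_ne_zero (t, y)
  field_simp
  ring

theorem polyBddUpTo_zero_comp (h : TameFlow Φ) {w : ℝ → ℝ} (hw : ContDiff ℝ (⊤ : ℕ∞) w) :
    PolyBddUpTo 0 (fun p => w (Φ p)) := by
  refine ⟨hw.comp h.contDiff, ?_⟩
  obtain ⟨c, hc⟩ := (isCompact_Icc (a := (-1 : ℝ)) (b := 1)).exists_bound_of_continuousOn
    hw.continuous.continuousOn
  exact .of_bounded fun p hp => hc _ (abs_le.1 (h.maps p.1 p.2 hp))

theorem polyBddUpTo_succ_comp (h : TameFlow Φ) {m : ℕ} (hJ : PolyBddUpTo m (dY Φ)) {w : ℝ → ℝ}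
    (hw : ContDiff ℝ (⊤ : ℕ∞) w) : PolyBddUpTo (m + 1) (fun p => w (Φ p)) := by
  induction m generalizing w with
  | zero =>
    refine ⟨hw.comp h.contDiff, (h.polyBddUpTo_zero_comp hw).2, ?_⟩
    rw [dY_comp hw h.contDiff]
    exact (h.polyBddUpTo_zero_comp hw.deriv_top).mul hJ
  | succ m ih =>
    refine ⟨hw.comp h.contDiff, (h.polyBddUpTo_zero_comp hw).2, ?_⟩
    rw [dY_comp hw h.contDiff]
    exact (ih hJ.of_succ hw.deriv_top).mul hJ

theorem polyBddUpTo_dY (h : TameFlow Φ) (m : ℕ) : PolyBddUpTo m (dY Φ) := by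
  induction m with
  | zero => exact ⟨contDiff_dY h.contDiff, h.bdd⟩
  | succ m ih =>
    have hM : PolyBddUpTo m (logJac Φ) := by
      refine .of_dT h.contDiff_logJac (fun y => ?_) ?_
      · simp [logJac, dY_eq_zero_of_const (contDiff_dY h.contDiff) h.dY_zero]
      · rw [h.dT_logJac]
        exact (h.polyBddUpTo_succ_comp ih h.contDiff_field.deriv_top.deriv_top).of_succ.mul ih
    refine ⟨ih.contDiff, ih.polyBddTime, ?_⟩
    have e : dY (dY Φ) = fun p => dY Φ p * logJac Φ p := by
      funext p
      simp only [logJac]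
      field_simp [h.dY_ne_zero p]
    rw [e]
    exact ih.mul hM

theorem polyBddTime_iterate (h : TameFlow Φ) {w : ℝ → ℝ} (hw : ContDiff ℝ (⊤ : ℕ∞) w) (i : ℕ) :
    PolyBddTime (dY^[i] fun p => w (Φ p)) :=
  (h.polyBddUpTo_succ_comp (h.polyBddUpTo_dY i) hw).of_succ.iterate

end TameFlow

/-- A diffeomorphism from `(-1, 1)` onto the line. -/
noncomputable def spread (y : ℝ) : ℝ := y / (1 - y ^ 2)

/-- The inverse of `spread` on `(-1, 1)`. -/
noncomputable def unspread (h : ℝ) : ℝ := 2 * h / (1 + √(1 + 4 * h ^ 2))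

theorem one_sub_unspread_sq (h : ℝ) : 1 - unspread h ^ 2 = 2 / (1 + √(1 + 4 * h ^ 2)) := by
  have hR : √(1 + 4 * h ^ 2) ^ 2 = 1 + 4 * h ^ 2 := Real.sq_sqrt (by positivity)
  have hR0 : 0 ≤ √(1 + 4 * h ^ 2) := Real.sqrt_nonneg _
  rw [unspread]
  generalize √(1 + 4 * h ^ 2) = R at hR hR0
  field_simp
  nlinarith

theorem unspread_sq_lt_one (h : ℝ) : unspread h ^ 2 < 1 := by
  have : 0 < 2 / (1 + √(1 + 4 * h ^ 2)) := by positivity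
  linarith [one_sub_unspread_sq h]

theorem abs_unspread_lt_one (h : ℝ) : |unspread h| < 1 :=
  (sq_lt_one_iff_abs_lt_one _).1 (unspread_sq_lt_one h)

theorem spread_unspread (h : ℝ) : spread (unspread h) = h := by
  rw [spread, one_sub_unspread_sq, unspread]
  have : 0 ≤ √(1 + 4 * h ^ 2) := Real.sqrt_nonneg _
  field_simp

theorem sqrt_one_add_spread {y : ℝ} (hy : |y| < 1) :
    √(1 + 4 * spread y ^ 2) = (1 + y ^ 2) / (1 - y ^ 2) := by
  have h1 : 0 < 1 - y ^ 2 := by linarith [(sq_lt_one_iff_abs_lt_one y).2 hy]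
  rw [spread, show 1 + 4 * (y / (1 - y ^ 2)) ^ 2 = ((1 + y ^ 2) / (1 - y ^ 2)) ^ 2 by
    field_simp; ring]
  exact Real.sqrt_sq (by positivity)

theorem unspread_spread {y : ℝ} (hy : |y| < 1) : unspread (spread y) = y := by
  have h1 : 0 < 1 - y ^ 2 := by linarith [(sq_lt_one_iff_abs_lt_one y).2 hy]
  rw [unspread, sqrt_one_add_spread hy, spread]
  field_simp
  ring

theorem spread_neg (y : ℝ) : spread (-y) = -spread y := by simp [spread, neg_div]

theorem unspread_neg (h : ℝ) : unspread (-h) = -unspread h := by simp [unspread, neg_div]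

theorem unspread_eq_zero {h : ℝ} : unspread h = 0 ↔ h = 0 := by
  have : (1 + √(1 + 4 * h ^ 2)) ≠ 0 := by positivity
  simp [unspread, this]

theorem contDiff_unspread : ContDiff ℝ (⊤ : ℕ∞) unspread := by
  unfold unspread
  refine (contDiff_const.mul contDiff_id).div (contDiff_const.add
    (ContDiff.sqrt (by fun_prop) fun x => by positivity)) fun x => by positivity

theorem contDiffAt_spread {y : ℝ} (hy : |y| < 1) : ContDiffAt ℝ (⊤ : ℕ∞) spread y := by
  have h1 : 0 < 1 - y ^ 2 := by linarith [(sq_lt_one_iff_abs_lt_one y).2 hy]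
  unfold spread
  exact ContDiffAt.div (by fun_prop) (by fun_prop) h1.ne'

theorem hasDerivAt_spread {y : ℝ} (hy : |y| < 1) :
    HasDerivAt spread ((1 + 4 * spread y ^ 2) / (1 + y ^ 2)) y := by
  have h1 : 0 < 1 - y ^ 2 := by linarith [(sq_lt_one_iff_abs_lt_one y).2 hy]
  have := (hasDerivAt_id y).fun_div (((hasDerivAt_id y).fun_pow 2).const_sub 1) h1.ne'
  refine this.congr_deriv ?_
  simp only [id, spread]
  field_simp
  norm_num
  ring

/-- The flow supported in `[-1, 1]` which becomes translation in the coordinate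
`sinh (spread y)`. -/
noncomputable def bumpFlow (p : ℝ × ℝ) : ℝ :=
  if |p.2| < 1 then unspread (Real.arsinh (Real.sinh (spread p.2) + p.1)) else p.2

theorem bumpFlow_of_lt {t y : ℝ} (hy : |y| < 1) :
    bumpFlow (t, y) = unspread (Real.arsinh (Real.sinh (spread y) + t)) := if_pos hy

theorem bumpFlow_of_le {t y : ℝ} (hy : 1 ≤ |y|) : bumpFlow (t, y) = y := if_neg hy.not_gt

theorem sinh_spread_bumpFlow {t y : ℝ} (hy : |y| < 1) :
    Real.sinh (spread (bumpFlow (t, y))) = Real.sinh (spread y) + t := by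
  rw [bumpFlow_of_lt hy, spread_unspread, Real.sinh_arsinh]

theorem abs_bumpFlow_lt {t y : ℝ} (hy : |y| < 1) : |bumpFlow (t, y)| < 1 := by
  rw [bumpFlow_of_lt hy]
  exact abs_unspread_lt_one _

theorem bumpFlow_zero (y : ℝ) : bumpFlow (0, y) = y := by
  rcases lt_or_ge |y| 1 with hy | hy
  · rw [bumpFlow_of_lt hy, add_zero, Real.arsinh_sinh, unspread_spread hy]
  · exact bumpFlow_of_le hy

theorem bumpFlow_comp (s t y : ℝ) : bumpFlow (s, bumpFlow (t, y)) = bumpFlow (s + t, y) := by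
  rcases lt_or_ge |y| 1 with hy | hy
  · rw [bumpFlow_of_lt (abs_bumpFlow_lt hy), sinh_spread_bumpFlow hy, bumpFlow_of_lt hy]
    congr 2
    ring
  · simp only [bumpFlow_of_le hy]

theorem bumpFlow_neg (t y : ℝ) : bumpFlow (t, y) = -bumpFlow (-t, -y) := by
  rcases lt_or_ge |y| 1 with hy | hy
  · rw [bumpFlow_of_lt hy, bumpFlow_of_lt (by rwa [abs_neg]), spread_neg, Real.sinh_neg,
      ← neg_add, Real.arsinh_neg, unspread_neg, neg_neg]
  · rw [bumpFlow_of_le hy, bumpFlow_of_le (by rwa [abs_neg]), neg_neg]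

theorem unspread_inv {q : ℝ} (hq : 0 < q) : unspread q⁻¹ = (√(q ^ 2 + 4) - q) / 2 := by
  have e : √(1 + 4 * q⁻¹ ^ 2) = √(q ^ 2 + 4) / q := by
    rw [show 1 + 4 * q⁻¹ ^ 2 = (q ^ 2 + 4) / q ^ 2 by field_simp,
      Real.sqrt_div (by positivity), Real.sqrt_sq hq.le]
  have hr : √(q ^ 2 + 4) ^ 2 = q ^ 2 + 4 := Real.sq_sqrt (by positivity)
  have hr0 : 0 ≤ √(q ^ 2 + 4) := Real.sqrt_nonneg _
  rw [unspread, e]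
  generalize √(q ^ 2 + 4) = r at hr hr0
  field_simp
  nlinarith

theorem arsinh_sinh_inv_add {q : ℝ} (hq : 0 < q) (t : ℝ)
    {g P : ℝ} (hg : g = expNegInvGlue q) (hP : P = (1 - g ^ 2) / 2 + t * g)
    (hA : 0 < P + √(g ^ 2 + P ^ 2)) :
    Real.arsinh (Real.sinh q⁻¹ + t) = q⁻¹ + Real.log (P + √(g ^ 2 + P ^ 2)) := by
  have hg' : g = Real.exp (-q⁻¹) := by rw [hg, expNegInvGlue, if_neg hq.not_ge]
  have hg0 : 0 < g := hg' ▸ Real.exp_pos _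
  have hS : Real.sinh q⁻¹ + t = P / g := by
    rw [Real.sinh_eq, ← hg', show Real.exp q⁻¹ = g⁻¹ by rw [hg', Real.exp_neg, inv_inv], hP]
    field_simp
  have e : √(1 + (P / g) ^ 2) = √(g ^ 2 + P ^ 2) / g := by
    rw [show 1 + (P / g) ^ 2 = (g ^ 2 + P ^ 2) / g ^ 2 by field_simp,
      Real.sqrt_div (by positivity), Real.sqrt_sq hg0.le]
  rw [hS, Real.arsinh, e, ← add_div, Real.log_div hA.ne' hg0.ne', hg', Real.log_exp]
  ring

theorem contDiffAt_bumpFlow_one (t : ℝ) : ContDiffAt ℝ (⊤ : ℕ∞) bumpFlow (t, 1) := by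
  let q : ℝ × ℝ → ℝ := fun p => p.2⁻¹ - p.2
  let g : ℝ × ℝ → ℝ := fun p => expNegInvGlue (q p)
  let P : ℝ × ℝ → ℝ := fun p => (1 - g p ^ 2) / 2 + p.1 * g p
  let A : ℝ × ℝ → ℝ := fun p => P p + √(g p ^ 2 + P p ^ 2)
  let d : ℝ × ℝ → ℝ := fun p => 1 + q p * Real.log (A p)
  let q' : ℝ × ℝ → ℝ := fun p => q p / d p
  have q1 : q (t, 1) = 0 := by simp [q]
  have g1 : g (t, 1) = 0 := by simp [g, q1]
  have P1 : P (t, 1) = 1 / 2 := by simp [P, g1]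
  have A1 : A (t, 1) = 1 := by
    simp only [A, g1, P1]
    rw [show (0 : ℝ) ^ 2 + (1 / 2) ^ 2 = (1 / 2) ^ 2 by norm_num, Real.sqrt_sq (by norm_num)]
    norm_num
  have d1 : d (t, 1) = 1 := by simp [d, q1]
  have hq : ContDiffAt ℝ (⊤ : ℕ∞) q (t, 1) :=
    (contDiffAt_snd.inv (by simp)).sub contDiffAt_snd
  have hg : ContDiffAt ℝ (⊤ : ℕ∞) g (t, 1) := expNegInvGlue.contDiff.contDiffAt.comp _ hq
  have hP : ContDiffAt ℝ (⊤ : ℕ∞) P (t, 1) :=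
    ((contDiffAt_const.sub (hg.pow 2)).div_const 2).add (contDiffAt_fst.mul hg)
  have hA : ContDiffAt ℝ (⊤ : ℕ∞) A (t, 1) :=
    hP.add (((hg.pow 2).add (hP.pow 2)).sqrt (by simp [g1, P1]))
  have hd : ContDiffAt ℝ (⊤ : ℕ∞) d (t, 1) :=
    contDiffAt_const.add (hq.mul (hA.log (by simp [A1])))
  have hq' : ContDiffAt ℝ (⊤ : ℕ∞) q' (t, 1) := hq.div hd (by simp [d1])
  have hz : ContDiffAt ℝ (⊤ : ℕ∞) (fun p => (√(q' p ^ 2 + 4) - q' p) / 2) (t, 1) :=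
    ((((hq'.pow 2).add contDiffAt_const).sqrt (by positivity)).sub hq').div_const 2
  refine hz.congr_of_eventuallyEq ?_
  have e1 : ∀ᶠ p : ℝ × ℝ in nhds (t, 1), 0 < p.2 :=
    continuousAt_snd.eventually (lt_mem_nhds (by simp))
  have e2 : ∀ᶠ p in nhds (t, (1 : ℝ)), 0 < A p :=
    hA.continuousAt.eventually (lt_mem_nhds (by simp [A1]))
  have e3 : ∀ᶠ p in nhds (t, (1 : ℝ)), 0 < d p :=
    hd.continuousAt.eventually (lt_mem_nhds (by simp [d1]))
  filter_upwards [e1, e2, e3] with ⟨s, y⟩ hy hAp hdp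
  simp only at hy
  rcases lt_or_ge y 1 with hy1 | hy1
  · have hqp : 0 < q (s, y) := by
      have := one_lt_inv₀ hy |>.2 hy1
      simp only [q]
      linarith
    have hyabs : |y| < 1 := by rwa [abs_of_pos hy]
    have hspread : spread y = (q (s, y))⁻¹ := by
      have : (1 : ℝ) - y ^ 2 ≠ 0 := by nlinarith
      rw [spread, show q (s, y) = (1 - y ^ 2) / y by simp only [q]; field_simp, inv_div]
    rw [bumpFlow_of_lt hyabs, hspread, arsinh_sinh_inv_add hqp s rfl rfl hAp,
      ← unspread_inv (div_pos hqp hdp)]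
    congr 1
    simp only [inv_div]
    change _ + Real.log (A (s, y)) = _
    simp only [d]
    field_simp
  · have hqp : q (s, y) ≤ 0 := by
      have := inv_le_one_of_one_le₀ hy1
      simp only [q]
      linarith
    have hg0 : g (s, y) = 0 := expNegInvGlue.zero_of_nonpos hqp
    have hP0 : P (s, y) = 1 / 2 := by simp [P, hg0]
    have hA0 : A (s, y) = 1 := by
      simp only [A, hg0, hP0]
      rw [show (0 : ℝ) ^ 2 + (1 / 2) ^ 2 = (1 / 2) ^ 2 by norm_num, Real.sqrt_sq (by norm_num)]
      norm_num
    have hq0 : q' (s, y) = y⁻¹ - y := by simp [q', d, hA0, q]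
    rw [bumpFlow_of_le (hy1.trans (le_abs_self y)), hq0,
      show (y⁻¹ - y) ^ 2 + 4 = (y⁻¹ + y) ^ 2 by field_simp; ring, Real.sqrt_sq (by positivity)]
    ring

theorem contDiff_bumpFlow : ContDiff ℝ (⊤ : ℕ∞) bumpFlow := by
  rw [contDiff_iff_contDiffAt]
  rintro ⟨t, y⟩
  have habs : Continuous fun p : ℝ × ℝ => |p.2| := continuous_snd.abs
  rcases lt_trichotomy |y| 1 with hy | hy | hy
  · have e : bumpFlow =ᶠ[nhds (t, y)]
        fun p => unspread (Real.arsinh (Real.sinh (spread p.2) + p.1)) := by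
      filter_upwards [habs.continuousAt.eventually (gt_mem_nhds hy)] with p hp
      exact if_pos hp
    refine ContDiffAt.congr_of_eventuallyEq ?_ e
    have h1 : ContDiffAt ℝ (⊤ : ℕ∞) (fun p : ℝ × ℝ => spread p.2) (t, y) :=
      (contDiffAt_spread hy).comp (t, y) contDiffAt_snd
    exact contDiff_unspread.contDiffAt.comp (t, y) (h1.sinh.add contDiffAt_fst).arsinh
  · rcases eq_or_eq_neg_of_abs_eq hy with rfl | rfl
    · exact contDiffAt_bumpFlow_one t
    · have e : bumpFlow = fun p => -bumpFlow (-p) := by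
        funext ⟨s, z⟩
        exact bumpFlow_neg s z
      rw [e]
      have h1 : ContDiffAt ℝ (⊤ : ℕ∞) (fun p : ℝ × ℝ => -p) (t, -1) := contDiffAt_id.neg
      have h2 : ContDiffAt ℝ (⊤ : ℕ∞) bumpFlow (-(t, -1)) := by
        simpa using contDiffAt_bumpFlow_one (-t)
      exact (h2.comp (t, (-1 : ℝ)) h1).neg
  · have e : bumpFlow =ᶠ[nhds (t, y)] Prod.snd := by
      filter_upwards [habs.continuousAt.eventually (lt_mem_nhds hy)] with p hp
      exact if_neg (not_lt.2 hp.le)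
    exact contDiffAt_snd.congr_of_eventuallyEq e

theorem abs_arsinh_sub_le (a b : ℝ) : |Real.arsinh a - Real.arsinh b| ≤ |a - b| := by
  have := convex_univ.norm_image_sub_le_of_norm_hasDerivWithin_le (C := 1) (x := b) (y := a)
    (fun u _ => (Real.hasDerivAt_arsinh u).hasDerivWithinAt)
    (fun u _ => by
      rw [norm_inv, Real.norm_of_nonneg (Real.sqrt_nonneg _)]
      exact inv_le_one_of_one_le₀ (Real.one_le_sqrt.2 (by nlinarith [sq_nonneg u])))
    trivial trivial
  simpa using this

theorem abs_dY_bumpFlow_le {t y : ℝ} (hy : |y| < 1) :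
    |dY bumpFlow (t, y)| ≤ 16 * (1 + |t|) ^ 3 := by
  set z := bumpFlow (t, y) with hz
  set h := spread y with hh
  set k := spread z with hk
  have hkh : Real.sinh k = Real.sinh h + t := sinh_spread_bumpFlow hy
  have hz1 : |z| < 1 := abs_bumpFlow_lt hy
  have hder : Real.cosh k * ((1 + 4 * k ^ 2) / (1 + z ^ 2) * dY bumpFlow (t, y))
      = Real.cosh h * ((1 + 4 * h ^ 2) / (1 + y ^ 2)) := by
    have d1 := (HasDerivAt.comp y (hasDerivAt_spread hz1)
      (hasDerivAt_snd contDiff_bumpFlow t y)).sinh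
    have d2 := ((hasDerivAt_spread hy).sinh).add_const t
    refine d1.unique (d2.congr_of_eventuallyEq ?_)
    filter_upwards [continuous_abs.continuousAt.eventually (gt_mem_nhds hy)] with u hu
    exact sinh_spread_bumpFlow hu
  have hsub : |h - k| ≤ |t| := by
    have := abs_arsinh_sub_le (Real.sinh h) (Real.sinh k)
    rwa [Real.arsinh_sinh, Real.arsinh_sinh, hkh, sub_add_cancel_left, abs_neg] at this
  have ht := abs_nonneg t
  have hcosh : Real.cosh h ≤ Real.cosh k * (1 + |t|) := by
    rw [← pow_le_pow_iff_left₀ (Real.cosh_pos h).le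
      (mul_nonneg (Real.cosh_pos k).le (by positivity)) two_ne_zero, mul_pow, Real.cosh_sq,
      Real.cosh_sq, show Real.sinh h = Real.sinh k - t by rw [hkh]; ring]
    generalize Real.sinh k = u
    have h1 : -(2 * u * t) ≤ (u ^ 2 + 1) * (2 * |t|) := by
      have : -(u * t) ≤ |u| * |t| := by rw [← abs_mul]; exact neg_le_abs _
      nlinarith [sq_nonneg (|u| - 1), sq_abs u]
    nlinarith [sq_abs t, mul_nonneg (sq_nonneg u) (sq_nonneg |t|)]
  have hquad : 1 + 4 * h ^ 2 ≤ 8 * (1 + 4 * k ^ 2) * (1 + |t|) ^ 2 := by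
    have h1 : (h - k) ^ 2 ≤ |t| ^ 2 := by rw [← sq_abs (h - k)]; gcongr
    nlinarith [sq_nonneg (h - 2 * k), mul_nonneg (sq_nonneg k) ht,
      mul_nonneg (sq_nonneg k) (sq_nonneg |t|)]
  have hy2 := (sq_lt_one_iff_abs_lt_one y).2 hy
  have hz2 := (sq_lt_one_iff_abs_lt_one z).2 hz1
  have hck := Real.cosh_pos k
  have hX : 0 < Real.cosh k * ((1 + 4 * k ^ 2) / (1 + z ^ 2)) := by positivity
  have key : Real.cosh k * ((1 + 4 * k ^ 2) / (1 + z ^ 2)) * |dY bumpFlow (t, y)|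
      ≤ Real.cosh k * ((1 + 4 * k ^ 2) / (1 + z ^ 2)) * (16 * (1 + |t|) ^ 3) := by
    calc Real.cosh k * ((1 + 4 * k ^ 2) / (1 + z ^ 2)) * |dY bumpFlow (t, y)|
        = |Real.cosh k * ((1 + 4 * k ^ 2) / (1 + z ^ 2) * dY bumpFlow (t, y))| := by
          rw [← mul_assoc, abs_mul _ (dY bumpFlow (t, y)), abs_of_pos hX]
      _ = Real.cosh h * ((1 + 4 * h ^ 2) / (1 + y ^ 2)) := by
          rw [hder, abs_of_nonneg]
          have := Real.cosh_pos h
          positivity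
      _ ≤ Real.cosh h * (1 + 4 * h ^ 2) := by
          have := Real.cosh_pos h
          gcongr
          exact div_le_self (by positivity) (by nlinarith)
      _ ≤ (Real.cosh k * (1 + |t|)) * (8 * (1 + 4 * k ^ 2) * (1 + |t|) ^ 2) := by gcongr
      _ = Real.cosh k * ((1 + 4 * k ^ 2) / 2) * (16 * (1 + |t|) ^ 3) := by ring
      _ ≤ _ := by
          gcongr
          linarith
  exact le_of_mul_le_mul_left key hX

theorem tameFlow_bumpFlow : TameFlow bumpFlow where
  contDiff := contDiff_bumpFlow
  zero := bumpFlow_zero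
  comp := bumpFlow_comp
  maps t y hy := by
    rcases hy.lt_or_eq with hy' | hy'
    · exact (abs_bumpFlow_lt hy').le
    · rwa [bumpFlow_of_le hy'.ge]
  bdd := by
    refine ⟨16, 3, by norm_num, ?_⟩
    rintro ⟨t, y⟩ hy
    have hcont : Continuous fun y => |dY bumpFlow (t, y)| :=
      ((contDiff_dY contDiff_bumpFlow).continuous.comp (by fun_prop)).abs
    have hcl : closure (Set.Ioo (-1 : ℝ) 1) ⊆ {y | |dY bumpFlow (t, y)| ≤ 16 * (1 + |t|) ^ 3} :=
      closure_minimal (fun u hu => abs_dY_bumpFlow_le (abs_lt.2 hu))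
        (isClosed_le hcont continuous_const)
    rw [closure_Ioo (by norm_num)] at hcl
    exact hcl (abs_le.1 hy)

theorem mder_mem {n : ℕ} {ι : Type*} (S : (ι → (Fin n → ℝ) → ℝ) → Prop)
    (hS : ∀ F, S F → ∀ i, S fun a => pder i (F a)) {F : ι → (Fin n → ℝ) → ℝ} (hF : S F)
    (μ : Fin n → ℕ) : S fun a => mder μ (F a) := by
  unfold mder
  generalize List.finRange n = l
  induction l with
  | nil => exact hF
  | cons i l ih =>
    simp only [List.foldr_cons]
    generalize μ i = k
    induction k with
    | zero => exact ih
    | succ k ihk =>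
      simp only [Function.iterate_succ_apply']
      exact hS _ ihk i

theorem mder_zero {n : ℕ} (f : (Fin n → ℝ) → ℝ) : mder 0 f = f := by
  unfold mder
  induction List.finRange n with
  | nil => rfl
  | cons i l ih => simp

theorem contDiff_pder {n : ℕ} {f : (Fin n → ℝ) → ℝ} (hf : ContDiff ℝ (⊤ : ℕ∞) f) (i : Fin n) :
    ContDiff ℝ (⊤ : ℕ∞) (pder i f) :=
  (hf.fderiv_right (m := (⊤ : ℕ∞)) (by simp)).clm_apply contDiff_const

theorem pder_comp_prodMk {n : ℕ} {f : ℝ × ℝ → ℝ} {a b : (Fin n → ℝ) → ℝ}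
    (hf : ContDiff ℝ (⊤ : ℕ∞) f) (ha : ContDiff ℝ (⊤ : ℕ∞) a) (hb : ContDiff ℝ (⊤ : ℕ∞) b)
    (i : Fin n) :
    pder i (fun y => f (a y, b y)) =
      fun y => dT f (a y, b y) * pder i a y + dY f (a y, b y) * pder i b y := by
  funext y
  have h := (hf.differentiableAt_top (a y, b y)).hasFDerivAt.comp y
    ((ha.differentiableAt_top y).hasFDerivAt.prodMk (hb.differentiableAt_top y).hasFDerivAt)
  have e : fderiv ℝ (fun y => f (a y, b y)) y = _ := h.fderiv
  simp only [pder, dT, dY, e, ContinuousLinearMap.comp_apply, ContinuousLinearMap.prod_apply]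
  generalize fderiv ℝ a y (Pi.single i 1) = u
  generalize fderiv ℝ b y (Pi.single i 1) = v
  rw [show (u, v) = u • ((1 : ℝ), (0 : ℝ)) + v • ((0 : ℝ), (1 : ℝ)) by simp, map_add, map_smul,
    map_smul, smul_eq_mul, smul_eq_mul, mul_comm u, mul_comm v]

/-- The algebra of functions of `(x, y)` generated by smooth functions of `y`, the coordinate
`x i₀` and the space derivatives of observables of the flow `Φ` at time `x i₀ * χ y` and
position `ζ y`. -/
inductive FlowAlg {n : ℕ} (Φ : ℝ × ℝ → ℝ) (i₀ : Fin n) (χ ζ : (Fin n → ℝ) → ℝ) :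
    ((Fin n → ℝ) → (Fin n → ℝ) → ℝ) → Prop
  | space (f : (Fin n → ℝ) → ℝ) (hf : ContDiff ℝ (⊤ : ℕ∞) f) : FlowAlg Φ i₀ χ ζ fun _ y => f y
  | time : FlowAlg Φ i₀ χ ζ fun x _ => x i₀
  | flow (w : ℝ → ℝ) (hw : ContDiff ℝ (⊤ : ℕ∞) w) (k : ℕ) :
      FlowAlg Φ i₀ χ ζ fun x y => (dY^[k] fun p => w (Φ p)) (x i₀ * χ y, ζ y)
  | add {F G : (Fin n → ℝ) → (Fin n → ℝ) → ℝ} (hF : FlowAlg Φ i₀ χ ζ F)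
      (hG : FlowAlg Φ i₀ χ ζ G) : FlowAlg Φ i₀ χ ζ fun x y => F x y + G x y
  | mul {F G : (Fin n → ℝ) → (Fin n → ℝ) → ℝ} (hF : FlowAlg Φ i₀ χ ζ F)
      (hG : FlowAlg Φ i₀ χ ζ G) : FlowAlg Φ i₀ χ ζ fun x y => F x y * G x y

namespace FlowAlg

variable {n : ℕ} {Φ : ℝ × ℝ → ℝ} {i₀ : Fin n} {χ ζ : (Fin n → ℝ) → ℝ}
  {F : (Fin n → ℝ) → (Fin n → ℝ) → ℝ}

theorem contDiff (hΦ : TameFlow Φ) (hχ : ContDiff ℝ (⊤ : ℕ∞) χ) (hζ : ContDiff ℝ (⊤ : ℕ∞) ζ)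
    (hF : FlowAlg Φ i₀ χ ζ F) (x : Fin n → ℝ) : ContDiff ℝ (⊤ : ℕ∞) (F x) := by
  induction hF with
  | space f hf => exact hf
  | time => exact contDiff_const
  | flow w hw k =>
    exact (contDiff_iterate_dY (hw.comp hΦ.contDiff) k).comp ((contDiff_const.mul hχ).prodMk hζ)
  | add _ _ ihF ihG => exact ihF.add ihG
  | mul _ _ ihF ihG => exact ihF.mul ihG

theorem pder_mem (hΦ : TameFlow Φ) (hχ : ContDiff ℝ (⊤ : ℕ∞) χ) (hζ : ContDiff ℝ (⊤ : ℕ∞) ζ)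
    (hF : FlowAlg Φ i₀ χ ζ F) (i : Fin n) : FlowAlg Φ i₀ χ ζ fun x => pder i (F x) := by
  induction hF with
  | space f hf => exact .space _ (contDiff_pder hf i)
  | time =>
    have e : (fun x : Fin n → ℝ => pder i fun _ : Fin n → ℝ => x i₀) = fun _ _ => (0 : ℝ) := by
      funext x y
      simp [pder]
    rw [e]
    exact .space _ contDiff_const
  | flow w hw k =>
    have hwΦ : ContDiff ℝ (⊤ : ℕ∞) fun p => w (Φ p) := hw.comp hΦ.contDiff
    have e : (fun x : Fin n → ℝ => pder i fun y =>
        (dY^[k] fun p => w (Φ p)) (x i₀ * χ y, ζ y)) = fun x y =>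
        (dY^[k] fun p => (fun y => deriv w y * TameFlow.field Φ y) (Φ p)) (x i₀ * χ y, ζ y)
            * (x i₀ * pder i χ y)
          + (dY^[k + 1] fun p => w (Φ p)) (x i₀ * χ y, ζ y) * pder i ζ y := by
      funext x
      rw [pder_comp_prodMk (contDiff_iterate_dY hwΦ k) (contDiff_const.mul hχ) hζ,
        dT_iterate_dY hwΦ, hΦ.dT_comp_eq hw, Function.iterate_succ_apply']
      funext y
      congr 2
      simp only [pder]
      rw [fderiv_const_mul (hχ.differentiableAt_top y)]
      simp
    rw [e]
    exact .add (.mul (.flow _ (hw.deriv_top.mul hΦ.contDiff_field) k)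
      (.mul .time (.space _ (contDiff_pder hχ i))))
      (.mul (.flow w hw (k + 1)) (.space _ (contDiff_pder hζ i)))
  | @add F G hF hG ihF ihG =>
    have e : (fun x => pder i fun y => F x y + G x y)
        = fun x y => pder i (F x) y + pder i (G x) y := by
      funext x y
      simp only [pder]
      rw [fderiv_fun_add ((hF.contDiff hΦ hχ hζ x).differentiableAt_top y)
        ((hG.contDiff hΦ hχ hζ x).differentiableAt_top y)]
      simp
    rw [e]
    exact .add ihF ihG
  | @mul F G hF hG ihF ihG =>
    have e : (fun x => pder i fun y => F x y * G x y)
        = fun x y => F x y * pder i (G x) y + G x y * pder i (F x) y := by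
      funext x y
      simp only [pder]
      rw [fderiv_fun_mul ((hF.contDiff hΦ hχ hζ x).differentiableAt_top y)
        ((hG.contDiff hΦ hχ hζ x).differentiableAt_top y)]
      simp
    rw [e]
    exact .add (.mul hF ihG) (.mul hG ihF)

theorem polyBdd (hΦ : TameFlow Φ) {C : Set (Fin n → ℝ)} (hC : IsCompact C)
    (hχ : ∀ y ∈ C, |χ y| ≤ 1) (hζ : ∀ y ∈ C, |ζ y| ≤ 1) (hF : FlowAlg Φ i₀ χ ζ F) :
    PolyBdd (fun a : (Fin n → ℝ) × (Fin n → ℝ) => ‖a.1‖) {a | a.2 ∈ C}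
      fun a => F a.1 a.2 := by
  induction hF with
  | space f hf =>
    obtain ⟨c, hc⟩ := hC.exists_bound_of_continuousOn hf.continuous.continuousOn
    exact .of_bounded fun a ha => hc _ ha
  | time =>
    refine ⟨1, 1, zero_le_one, fun a _ => ?_⟩
    have : |a.1 i₀| ≤ ‖a.1‖ := norm_le_pi_norm a.1 i₀
    linarith
  | flow w hw k =>
    obtain ⟨c, b, hc, h⟩ := hΦ.polyBddTime_iterate hw k
    refine ⟨c, b, hc, fun a ha => (h (a.1 i₀ * χ a.2, ζ a.2) (hζ _ ha)).trans ?_⟩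
    have h1 : |a.1 i₀ * χ a.2| ≤ ‖a.1‖ := by
      rw [abs_mul]
      exact (mul_le_of_le_one_right (abs_nonneg _) (hχ _ ha)).trans (norm_le_pi_norm a.1 i₀)
    dsimp only
    gcongr
  | add _ _ ihF ihG => exact .add (fun _ => norm_nonneg _) ihF ihG
  | mul _ _ ihF ihG => exact .mul (fun _ => norm_nonneg _) ihF ihG

end FlowAlg

/-- Functions of `(y, x)` that are affine over the smooth functions of `y` in an observable of the
flow `Φ` at time `x i₀ * χ y` and position `ζ y`. -/
def FlowAffine {n : ℕ} (Φ : ℝ × ℝ → ℝ) (i₀ : Fin n) (χ ζ : (Fin n → ℝ) → ℝ)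
    (F : (Fin n → ℝ) → (Fin n → ℝ) → ℝ) : Prop :=
  ∃ (f g : (Fin n → ℝ) → ℝ) (w : ℝ → ℝ), ContDiff ℝ (⊤ : ℕ∞) f ∧ ContDiff ℝ (⊤ : ℕ∞) g ∧
    ContDiff ℝ (⊤ : ℕ∞) w ∧ F = fun y x => f y + g y * w (Φ (x i₀ * χ y, ζ y))

namespace FlowAffine

variable {n : ℕ} {Φ : ℝ × ℝ → ℝ} {i₀ : Fin n} {χ ζ : (Fin n → ℝ) → ℝ}
  {F : (Fin n → ℝ) → (Fin n → ℝ) → ℝ}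

theorem pder_mem (hΦ : TameFlow Φ) (hχ : ContDiff ℝ (⊤ : ℕ∞) χ)
    (hF : FlowAffine Φ i₀ χ ζ F) (i : Fin n) : FlowAffine Φ i₀ χ ζ fun y => pder i (F y) := by
  obtain ⟨f, g, w, hf, hg, hw, rfl⟩ := hF
  refine ⟨fun _ => 0, fun y => (Pi.single i 1 : Fin n → ℝ) i₀ * χ y * g y,
    fun z => deriv w z * TameFlow.field Φ z, contDiff_const, (contDiff_const.mul hχ).mul hg,
    hw.deriv_top.mul hΦ.contDiff_field, ?_⟩
  funext y x
  have h1 : HasFDerivAt (fun x : Fin n → ℝ => x i₀ * χ y)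
      (χ y • (ContinuousLinearMap.proj i₀ : (Fin n → ℝ) →L[ℝ] ℝ)) x :=
    (hasFDerivAt_apply i₀ x).mul_const (χ y)
  have h2 := hasDerivAt_fst (hw.comp hΦ.contDiff) (x i₀ * χ y) (ζ y)
  have h3 := ((h2.comp_hasFDerivAt x h1).const_mul (g y)).const_add (f y)
  have e : fderiv ℝ (fun x => f y + g y * w (Φ (x i₀ * χ y, ζ y))) x = _ := h3.fderiv
  have e2 : dT (w ∘ Φ) = _ := hΦ.dT_comp_eq hw
  simp only [pder, e, e2]
  simp
  ring

theorem flowAlg (hF : FlowAffine Φ i₀ χ ζ F) : FlowAlg Φ i₀ χ ζ fun x y => F y x := by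
  obtain ⟨f, g, w, hf, hg, hw, rfl⟩ := hF
  exact .add (.space f hf) (.mul (.space g hg) (.flow w hw 0))

theorem exists_bound (hΦ : TameFlow Φ) {C : Set (Fin n → ℝ)} (hC : IsCompact C)
    (hζ : ∀ y ∈ C, |ζ y| ≤ 1) (hF : FlowAffine Φ i₀ χ ζ F) :
    ∃ c, ∀ x, ∀ y ∈ C, |F y x| ≤ c := by
  obtain ⟨f, g, w, hf, hg, hw, rfl⟩ := hF
  obtain ⟨c, hc⟩ := hC.exists_bound_of_continuousOn hf.continuous.continuousOn
  obtain ⟨d, hd⟩ := hC.exists_bound_of_continuousOn hg.continuous.continuousOn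
  obtain ⟨e, he⟩ := (isCompact_Icc (a := (-1 : ℝ)) (b := 1)).exists_bound_of_continuousOn
    hw.continuous.continuousOn
  refine ⟨c + d * e, fun x y hy => ?_⟩
  have h1 : |w (Φ (x i₀ * χ y, ζ y))| ≤ e := he _ (abs_le.1 (hΦ.maps _ _ (hζ y hy)))
  have hd' : |g y| ≤ d := hd y hy
  calc |f y + g y * w (Φ (x i₀ * χ y, ζ y))|
      ≤ |f y| + |g y| * |w (Φ (x i₀ * χ y, ζ y))| := by
        rw [← abs_mul]
        exact abs_add_le _ _
    _ ≤ c + d * e :=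
      add_le_add (hc y hy) (mul_le_mul hd' h1 (abs_nonneg _) ((abs_nonneg _).trans hd'))

theorem exists_mder_bound (hΦ : TameFlow Φ) (hχ : ContDiff ℝ (⊤ : ℕ∞) χ)
    (hζ : ContDiff ℝ (⊤ : ℕ∞) ζ) {C : Set (Fin n → ℝ)} (hC : IsCompact C)
    (hχC : ∀ y ∈ C, |χ y| ≤ 1) (hζC : ∀ y ∈ C, |ζ y| ≤ 1) (hF : FlowAffine Φ i₀ χ ζ F)
    (μ ν : Fin n → ℕ) :
    ∃ c : ℝ, ∃ b : ℕ, 0 ≤ c ∧ (ν = 0 → b = 0) ∧ ∀ x, ∀ y ∈ C,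
      |mder ν (fun y' => mder μ (F y') x) y| ≤ c * (1 + ‖x‖ ^ 2) ^ b := by
  have hG : FlowAffine Φ i₀ χ ζ fun y => mder μ (F y) :=
    mder_mem _ (fun _ h i => h.pder_mem hΦ hχ i) hF μ
  by_cases hν : ν = 0
  · subst hν
    obtain ⟨c, hc⟩ := hG.exists_bound hΦ hC hζC
    refine ⟨|c|, 0, abs_nonneg c, fun _ => rfl, fun x y hy => ?_⟩
    rw [mder_zero, pow_zero, mul_one]
    exact (hc x y hy).trans (le_abs_self c)
  · have hH := mder_mem (FlowAlg Φ i₀ χ ζ) (fun _ h i => h.pder_mem hΦ hχ hζ i) hG.flowAlg ν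
    obtain ⟨c, b, hc, h⟩ := hH.polyBdd hΦ hC hχC hζC
    refine ⟨c * 2 ^ b, b, by positivity, fun h0 => absurd h0 hν, fun x y hy => ?_⟩
    have h1 : 1 + ‖x‖ ≤ 2 * (1 + ‖x‖ ^ 2) := by nlinarith [sq_nonneg (‖x‖ - 1)]
    calc _ ≤ c * (1 + ‖x‖) ^ b := h (x, y) hy
      _ ≤ c * (2 * (1 + ‖x‖ ^ 2)) ^ b := by gcongr
      _ = _ := by rw [mul_pow, mul_assoc]

end FlowAffine

theorem statement19 {n : ℕ} (hn : 1 ≤ n) (K : Set (Fin n → ℝ)) (hK : IsOpen K)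
    (hKne : K.Nonempty) :
    ∃ τ : (Fin n → ℝ) → (Fin n → ℝ) → (Fin n → ℝ), ∃ C : Set (Fin n → ℝ),
      IsCompact C ∧ C ⊆ K ∧
      ContDiff ℝ (⊤ : ℕ∞) (fun p : (Fin n → ℝ) × (Fin n → ℝ) => τ p.1 p.2) ∧
      (∀ y, τ 0 y = y) ∧
      (∀ x x' y, τ x (τ x' y) = τ (x + x') y) ∧
      (∀ x y, y ∉ C → τ x y = y) ∧
      (∃ x y, τ x y ≠ y) ∧
      (∀ μ ν : Fin n → ℕ, ∃ c : ℝ, 0 < c ∧ ∃ b : ℝ, 0 ≤ b ∧ (ν = 0 → b = 0) ∧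
        ∀ x : Fin n → ℝ, ∀ y ∈ C, ∀ j : Fin n,
          |mder ν (fun y' => mder μ (fun x' => τ x' y' j) x) y| ≤
            c * (1 + ‖x‖ ^ 2) ^ (b / 2)) := by
  obtain ⟨p, hp⟩ := hKne
  obtain ⟨r, hr, hball⟩ := Metric.nhds_basis_closedBall.mem_iff.1 (hK.mem_nhds hp)
  let i₀ : Fin n := ⟨0, hn⟩
  let ζ : (Fin n → ℝ) → ℝ := fun y => (y i₀ - p i₀) / r
  let χ : (Fin n → ℝ) → ℝ := fun y =>
    ∏ i ∈ Finset.univ.erase i₀, Real.smoothTransition (1 - ((y i - p i) / r) ^ 2)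
  have hζ : ContDiff ℝ (⊤ : ℕ∞) ζ := ((contDiff_apply ℝ ℝ i₀).sub contDiff_const).div_const r
  have hχ : ContDiff ℝ (⊤ : ℕ∞) χ := contDiff_prod fun i _ =>
    Real.smoothTransition.contDiff.comp
      (contDiff_const.sub ((((contDiff_apply ℝ ℝ i).sub contDiff_const).div_const r).pow 2))
  have hχ1 : ∀ y, |χ y| ≤ 1 := fun y => by
    rw [abs_of_nonneg (Finset.prod_nonneg fun i _ => Real.smoothTransition.nonneg _)]
    exact Finset.prod_le_one (fun i _ => Real.smoothTransition.nonneg _)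
      fun i _ => Real.smoothTransition.le_one _
  have hdiv : ∀ a b : ℝ, |(a - b) / r| ≤ 1 ↔ |a - b| ≤ r := fun a b => by
    rw [abs_div, abs_of_pos hr, div_le_one hr]
  have hmem : ∀ y, y ∈ Metric.closedBall p r ↔ ∀ i, |y i - p i| ≤ r := fun y => by
    rw [Metric.mem_closedBall, dist_pi_le_iff hr.le]
    rfl
  have hζ1 : ∀ y ∈ Metric.closedBall p r, |ζ y| ≤ 1 := fun y hy =>
    (hdiv _ _).2 ((hmem y).1 hy i₀)
  have hΦ := tameFlow_bumpFlow
  let σ : (Fin n → ℝ) → (Fin n → ℝ) → ℝ := fun x y =>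
    p i₀ + r * bumpFlow (x i₀ * χ y, ζ y)
  have hχσ : ∀ y s, χ (Function.update y i₀ s) = χ y := fun y s =>
    Finset.prod_congr rfl fun i hi => by
      rw [Function.update_of_ne (Finset.ne_of_mem_erase hi)]
  have hζσ : ∀ y s, ζ (Function.update y i₀ (p i₀ + r * s)) = s := fun y s => by
    simp only [ζ, Function.update_self]
    field_simp
    ring
  have hfix : ∀ x y, bumpFlow (x i₀ * χ y, ζ y) = ζ y → Function.update y i₀ (σ x y) = y :=
    fun x y h => by
      rw [Function.update_eq_self_iff]
      simp only [σ, h, ζ]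
      field_simp
      ring
  refine ⟨fun x y => Function.update y i₀ (σ x y), Metric.closedBall p r,
    isCompact_closedBall p r, hball, ?_, fun y => ?_, fun x x' y => ?_, fun x y hy => ?_, ?_, ?_⟩
  · rw [contDiff_pi]
    intro j
    by_cases hj : j = i₀
    · subst hj
      simp only [Function.update_self]
      exact contDiff_const.add (contDiff_const.mul (hΦ.contDiff.comp
        ((((contDiff_apply ℝ ℝ _).comp contDiff_fst).mul (hχ.comp contDiff_snd)).prodMk
          (hζ.comp contDiff_snd))))
    · simp only [Function.update_of_ne hj]
      exact (contDiff_apply ℝ ℝ j).comp contDiff_snd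
  · refine hfix 0 y ?_
    rw [Pi.zero_apply, zero_mul, hΦ.zero]
  · simp only [Function.update_idem]
    congr 1
    simp only [σ, hχσ, hζσ, hΦ.comp, Pi.add_apply, add_mul]
  · refine hfix x y ?_
    rw [hmem] at hy
    push Not at hy
    obtain ⟨i, hi⟩ := hy
    have hi1 : 1 < |(y i - p i) / r| := lt_of_not_ge fun h => hi.not_ge ((hdiv _ _).1 h)
    by_cases hii : i = i₀
    · subst hii
      exact bumpFlow_of_le hi1.le
    · have : χ y = 0 := by
        refine Finset.prod_eq_zero (Finset.mem_erase.2 ⟨hii, Finset.mem_univ i⟩)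
          (Real.smoothTransition.zero_of_nonpos ?_)
        rw [← sq_abs]
        nlinarith
      rw [this, mul_zero, hΦ.zero]
  · refine ⟨fun _ => 1, p, fun h => ?_⟩
    have hχp : χ p = 1 := Finset.prod_eq_one fun i _ => by simp
    have hζp : ζ p = 0 := by simp [ζ]
    have h1 := Function.update_eq_self_iff.1 h
    simp only [σ, hχp, hζp, bumpFlow_of_lt (show |(0 : ℝ)| < 1 by simp)] at h1
    simp [unspread_eq_zero, spread, hr.ne'] at h1
  · intro μ ν
    have hF : ∀ j, FlowAffine bumpFlow i₀ χ ζ fun y x => Function.update y i₀ (σ x y) j := by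
      intro j
      by_cases hj : j = i₀
      · refine ⟨fun _ => p i₀, fun _ => r, id, contDiff_const, contDiff_const, contDiff_id, ?_⟩
        subst hj
        simp [σ]
      · refine ⟨fun y => y j, fun _ => 0, id, contDiff_apply ℝ ℝ j, contDiff_const, contDiff_id,
          ?_⟩
        simp [Function.update_of_ne hj]
    choose c b hc hb h using fun j =>
      (hF j).exists_mder_bound hΦ hχ hζ (isCompact_closedBall p r) (fun y _ => hχ1 y) hζ1 μ ν
    refine ⟨1 + ∑ j, c j, by linarith [Finset.sum_nonneg fun j (_ : j ∈ Finset.univ) => hc j],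
      2 * (∑ j, b j : ℕ), by positivity, fun hν => by simp [hb _ hν], fun x y hy j => ?_⟩
    rw [mul_div_cancel_left₀ _ two_ne_zero, Real.rpow_natCast]
    have h1 : 1 ≤ 1 + ‖x‖ ^ 2 := by linarith [sq_nonneg ‖x‖]
    have hcj : c j ≤ 1 + ∑ j, c j := by
      linarith [Finset.single_le_sum (fun j _ => hc j) (Finset.mem_univ j)]
    have hbj : b j ≤ ∑ j, b j :=
      Finset.single_le_sum (fun j _ => Nat.zero_le (b j)) (Finset.mem_univ j)
    calc _ ≤ c j * (1 + ‖x‖ ^ 2) ^ b j := h j x y hy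
      _ ≤ (1 + ∑ j, c j) * (1 + ‖x‖ ^ 2) ^ ∑ j, b j :=
        mul_le_mul hcj (pow_le_pow_right₀ h1 hbj) (by positivity) ((hc j).trans hcj)
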